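/- arXiv:2412.20915 — 3 statements merged into one kernel-verified Lean document; each statement's English description precedes it below -/
import Mathlib

section
/- Let M be a nonzero complex 3×3 matrix with Mᵀ = M and trace 0, and let N(M) denote the number of one-dimensional complex subspaces ℓ ⊆ ℂ³ that are spanned by an eigenvector z of M with b(z,z) ≠ 0. Then: (1) N(M) = 3 if and only if M has three distinct eigenvalues (Petrov Type I); (2) N(M) is infinite if and only if either M is diagonalizable with exactly two distinct eigenvalues (Type D), or M has exactly one distinct eigenvalue and the sum of its eigenspaces is 2-dimensional (Type N); (3) N(M) = 1 if and only if M is not diagonalizable and has exactly two distinct eigenvalues (Type II); (4) N(M) = 0 if and only if the sum of the eigenspaces of M is 1-dimensional (Type III). -/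
open Matrix

/-- Vectors in ℂ³. -/
abbrev C3 : Type := Fin 3 → ℂ

/-- The symmetric bilinear form `b(z,w) = z₁w₁ + z₂w₂ + z₃w₃` on ℂ³. -/
def b (z w : C3) : ℂ := z 0 * w 0 + z 1 * w 1 + z 2 * w 2

/-- `M` is diagonalizable over ℂ: there is a basis of ℂ³ of eigenvectors of `M`. -/
def Diagonalizable3 (M : Matrix (Fin 3) (Fin 3) ℂ) : Prop :=
  ∃ (v : Fin 3 → C3) (μ : Fin 3 → ℂ),
    LinearIndependent ℂ v ∧ Submodule.span ℂ (Set.range v) = ⊤ ∧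
    ∀ i, M.mulVec (v i) = μ i • v i

/-- The span of all eigenvectors of `M` (the sum of all eigenspaces). -/
noncomputable def eigSpan (M : Matrix (Fin 3) (Fin 3) ℂ) : Submodule ℂ C3 :=
  Submodule.span ℂ {z : C3 | z ≠ 0 ∧ ∃ μ : ℂ, M.mulVec z = μ • z}

/-- The set of (distinct) eigenvalues of `M`. -/
def spec3 (M : Matrix (Fin 3) (Fin 3) ℂ) : Set ℂ :=
  {μ : ℂ | ∃ z : C3, z ≠ 0 ∧ M.mulVec z = μ • z}

/-- The set of one-dimensional subspaces `ℓ ⊆ ℂ³` spanned by an eigenvector `z`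
of `M` with `b(z,z) ≠ 0`; its cardinality is `N(M)`. -/
def eigLines (M : Matrix (Fin 3) (Fin 3) ℂ) : Set (Submodule ℂ C3) :=
  {ℓ | ∃ z : C3, z ≠ 0 ∧ (∃ μ : ℂ, M.mulVec z = μ • z) ∧ b z z ≠ 0 ∧
        ℓ = Submodule.span ℂ {z}}

namespace Petrov

theorem b_eq_dotProduct (z w : C3) : b z w = z ⬝ᵥ w := by
  simp [b, dotProduct, Fin.sum_univ_three]

theorem b_comm (z w : C3) : b z w = b w z := by
  simp only [b]; ring

@[simp] theorem b_add_left (x y w : C3) : b (x + y) w = b x w + b y w := by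
  simp [b_eq_dotProduct]

@[simp] theorem b_add_right (x y w : C3) : b w (x + y) = b w x + b w y := by
  simp [b_eq_dotProduct]

@[simp] theorem b_smul_left (c : ℂ) (x w : C3) : b (c • x) w = c * b x w := by
  simp [b_eq_dotProduct]

@[simp] theorem b_smul_right (c : ℂ) (x w : C3) : b w (c • x) = c * b w x := by
  simp [b_eq_dotProduct]

@[simp] theorem b_zero_left (w : C3) : b 0 w = 0 := by
  simp [b_eq_dotProduct]

theorem ne_zero_of_b_ne_zero {z w : C3} (h : b z w ≠ 0) : z ≠ 0 := by
  rintro rfl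
  simp at h

theorem b_mulVec {M : Matrix (Fin 3) (Fin 3) ℂ} (hM : Mᵀ = M) (z w : C3) :
    b (M.mulVec z) w = b z (M.mulVec w) := by
  rw [b_eq_dotProduct, b_eq_dotProduct, dotProduct_mulVec, ← mulVec_transpose, hM]

theorem eigenvalue_sub_mul_b {M : Matrix (Fin 3) (Fin 3) ℂ} (hM : Mᵀ = M) {z w : C3} {k l : ℂ}
    (hz : M.mulVec z = k • z) (hw : M.mulVec w = l • w) : (k - l) * b z w = 0 := by
  have h := b_mulVec hM z w
  rw [hz, hw] at h
  simp only [b_smul_left, b_smul_right] at h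
  linear_combination h

/-- A totally isotropic subspace of `ℂ³` has dimension at most one. -/
theorem exists_eq_smul_of_isotropic {z w : C3} (hz0 : z ≠ 0) (hz : b z z = 0) (hw : b w w = 0)
    (hzw : b z w = 0) : ∃ c : ℂ, w = c • z := by
  simp only [b] at hz hw hzw
  have h12 : (z 1 * w 2 - z 2 * w 1) ^ 2 = 0 := by
    linear_combination (w 1 ^ 2 + w 2 ^ 2) * hz - z 0 ^ 2 * hw
      + (2 * z 0 * w 0 - (z 0 * w 0 + z 1 * w 1 + z 2 * w 2)) * hzw
  have h02 : (z 0 * w 2 - z 2 * w 0) ^ 2 = 0 := by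
    linear_combination (w 0 ^ 2 + w 2 ^ 2) * hz - z 1 ^ 2 * hw
      + (2 * z 1 * w 1 - (z 0 * w 0 + z 1 * w 1 + z 2 * w 2)) * hzw
  have h01 : (z 0 * w 1 - z 1 * w 0) ^ 2 = 0 := by
    linear_combination (w 0 ^ 2 + w 1 ^ 2) * hz - z 2 ^ 2 * hw
      + (2 * z 2 * w 2 - (z 0 * w 0 + z 1 * w 1 + z 2 * w 2)) * hzw
  rw [sq_eq_zero_iff] at h12 h02 h01
  obtain ⟨i, hi⟩ := Function.ne_iff.mp hz0
  refine ⟨w i / z i, funext fun j => ?_⟩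
  simp only [Pi.zero_apply] at hi
  simp only [Pi.smul_apply, smul_eq_mul]
  field_simp
  fin_cases i <;> fin_cases j <;> simp only [Fin.zero_eta, Fin.mk_one, Fin.reduceFinMk] <;> grind

/-- A basis of `ℂ³` that is orthonormal for the bilinear form `b`. -/
structure IsFrame (u p q : C3) : Prop where
  uu : b u u = 1
  pp : b p p = 1
  qq : b q q = 1
  up : b u p = 0
  uq : b u q = 0
  pq : b p q = 0

theorem exists_smul_b_eq_one {z : C3} (hz : b z z ≠ 0) :
    ∃ c : ℂ, b (c • z) (c • z) = 1 := by
  obtain ⟨s, hs⟩ := IsAlgClosed.exists_pow_nat_eq (b z z) (n := 2) (by norm_num)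
  have hs0 : s ≠ 0 := by
    rintro rfl
    exact hz (by rw [← hs]; simp)
  refine ⟨s⁻¹, ?_⟩
  simp only [b_smul_left, b_smul_right, ← hs]
  field_simp

theorem isFrame_crossProduct {u p : C3} (uu : b u u = 1) (pp : b p p = 1) (up : b u p = 0) :
    IsFrame u p (crossProduct u p) := by
  refine ⟨uu, pp, ?_, up, ?_, ?_⟩ <;> simp only [b, cross_apply] at * <;> simp <;> grind

theorem exists_isFrame {u : C3} (uu : b u u = 1) : ∃ p q, IsFrame u p q := by
  have key : ∃ p, b u p = 0 ∧ b p p ≠ 0 := by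
    by_contra! h
    have h0 := h ![0, -u 2, u 1] (by simp [b]; ring)
    have h1 := h ![u 2, 0, -u 0] (by simp [b]; ring)
    have h2 := h ![-u 1, u 0, 0] (by simp [b]; ring)
    simp [b] at h0 h1 h2 uu
    have : (2 : ℂ) = 0 := by linear_combination h0 + h1 + h2 - 2 * uu
    norm_num at this
  obtain ⟨p, hup, hpp⟩ := key
  obtain ⟨c, hc⟩ := exists_smul_b_eq_one hpp
  exact ⟨c • p, _, isFrame_crossProduct uu hc (by simp [hup])⟩

namespace IsFrame

variable {u p q : C3}

theorem rotate (h : IsFrame u p q) : IsFrame p q u :=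
  ⟨h.pp, h.qq, h.uu, h.pq, by rw [b_comm, h.up], by rw [b_comm, h.uq]⟩

theorem transpose_mul_self (h : IsFrame u p q) :
    (Matrix.of ![u, p, q])ᵀ * Matrix.of ![u, p, q] = 1 := by
  rw [mul_eq_one_comm]
  have pu := (b_comm p u).trans h.up
  have qu := (b_comm q u).trans h.uq
  have qp := (b_comm q p).trans h.pq
  have := h.uu
  have := h.pp
  have := h.qq
  have := h.up
  have := h.uq
  have := h.pq
  simp only [b] at *
  ext i j
  fin_cases i <;> fin_cases j <;> simpa [Matrix.mul_apply, Fin.sum_univ_three]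

theorem completeness (h : IsFrame u p q) (i j : Fin 3) :
    u i * u j + p i * p j + q i * q j = (1 : Matrix (Fin 3) (Fin 3) ℂ) i j := by
  rw [← h.transpose_mul_self]
  simp [Matrix.mul_apply, Fin.sum_univ_three]

theorem expand (h : IsFrame u p q) (z : C3) : z = b z u • u + b z p • p + b z q • q := by
  ext i
  have h0 := h.completeness i 0
  have h1 := h.completeness i 1
  have h2 := h.completeness i 2
  simp only [b, Pi.add_apply, Pi.smul_apply, smul_eq_mul]
  fin_cases i <;> simp [Matrix.one_apply] at h0 h1 h2 ⊢ <;>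
    linear_combination -z 0 * h0 - z 1 * h1 - z 2 * h2

theorem eq_zero (h : IsFrame u p q) {z : C3} (hu : b z u = 0) (hp : b z p = 0)
    (hq : b z q = 0) : z = 0 := by
  rw [h.expand z, hu, hp, hq]
  simp

theorem trace_eq (h : IsFrame u p q) (M : Matrix (Fin 3) (Fin 3) ℂ) :
    M.trace = b (M.mulVec u) u + b (M.mulVec p) p + b (M.mulVec q) q := by
  have hc := h.completeness
  have h00 := hc 0 0
  have h01 := hc 0 1
  have h02 := hc 0 2
  have h11 := hc 1 1
  have h12 := hc 1 2
  have h22 := hc 2 2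
  simp at h00 h01 h02 h11 h12 h22
  simp only [Matrix.trace, Matrix.diag, b, mulVec, dotProduct, Fin.sum_univ_three]
  linear_combination -M 0 0 * h00 - M 1 1 * h11 - M 2 2 * h22 - (M 0 1 + M 1 0) * h01
    - (M 0 2 + M 2 0) * h02 - (M 1 2 + M 2 1) * h12

theorem linearIndependent (h : IsFrame u p q) : LinearIndependent ℂ ![u, p, q] := by
  rw [Fintype.linearIndependent_iff]
  intro g hg
  simp only [Fin.sum_univ_three, cons_val_zero, cons_val_one, cons_val] at hg
  have hu := congrArg (b · u) hg
  have hp := congrArg (b · p) hg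
  have hq := congrArg (b · q) hg
  simp [h.uu, h.rotate.uq, h.rotate.rotate.up] at hu
  simp [h.pp, h.up, h.rotate.rotate.uq] at hp
  simp [h.qq, h.uq, h.pq] at hq
  intro i
  fin_cases i <;> assumption

theorem span_range (h : IsFrame u p q) : Submodule.span ℂ (Set.range ![u, p, q]) = ⊤ :=
  h.linearIndependent.span_eq_top_of_card_eq_finrank' (by simp)

end IsFrame

theorem span_singleton_ne {z w : C3} (hw : b w w ≠ 0) (hzw : b z w = 0) :
    Submodule.span ℂ {z} ≠ Submodule.span ℂ {w} := by
  intro h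
  have hmem : w ∈ Submodule.span ℂ {z} := h ▸ Submodule.mem_span_singleton_self w
  obtain ⟨c, hc⟩ := Submodule.mem_span_singleton.mp hmem
  have := congrArg (b · w) hc
  simp only [b_smul_left, hzw, mul_zero] at this
  exact hw this.symm

variable {M : Matrix (Fin 3) (Fin 3) ℂ}

theorem span_mem_eigLines {z : C3} {k : ℂ} (hz : M.mulVec z = k • z) (hb : b z z ≠ 0) :
    Submodule.span ℂ {z} ∈ eigLines M :=
  ⟨z, ne_zero_of_b_ne_zero hb, ⟨k, hz⟩, hb, rfl⟩

theorem span_smul_eq {z : C3} {c : ℂ} (h : c • z ≠ 0) :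
    Submodule.span ℂ {c • z} = Submodule.span ℂ {z} :=
  Submodule.span_singleton_smul_eq
    (IsUnit.mk0 c (by rintro rfl; simp at h)) z

theorem finrank_eigSpan_of_diagonalizable (h : Diagonalizable3 M) :
    Module.finrank ℂ (eigSpan M) = 3 := by
  obtain ⟨v, k, hv, hs, hk⟩ := h
  have : eigSpan M = ⊤ := by
    rw [eq_top_iff, ← hs]
    refine Submodule.span_mono ?_
    rintro _ ⟨i, rfl⟩
    exact ⟨hv.ne_zero i, k i, hk i⟩
  rw [this, finrank_top]
  simp

/-- The pencil spanned by a unit eigenvector `x` and an orthogonal eigenvector `y` with the same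
eigenvalue contains infinitely many non-isotropic lines. -/
theorem eigLines_infinite {x y : C3} {k : ℂ} (hx : M.mulVec x = k • x) (hy : M.mulVec y = k • y)
    (hxx : b x x = 1) (hxy : b x y = 0) (hy0 : y ≠ 0) (hyy : b y y = 0 ∨ b y y = 1) :
    (eigLines M).Infinite := by
  have hyx : b y x = 0 := by rw [b_comm, hxy]
  refine Set.infinite_of_injective_forall_mem
    (f := fun n : ℕ => Submodule.span ℂ {x + (n : ℂ) • y}) ?_ fun n => ?_
  · intro n m hnm
    simp only at hnm
    have hmem : x + (n : ℂ) • y ∈ Submodule.span ℂ {x + (m : ℂ) • y} :=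
      hnm ▸ Submodule.mem_span_singleton_self _
    obtain ⟨c, hc⟩ := Submodule.mem_span_singleton.mp hmem
    have hc1 : c = 1 := by
      simpa [hxx, hyx] using congrArg (b · x) hc
    subst hc1
    rw [one_smul, add_right_inj] at hc
    exact_mod_cast (smul_left_injective ℂ hy0 hc).symm
  · refine span_mem_eigLines (k := k) ?_ ?_
    · rw [mulVec_add, mulVec_smul, hx, hy, smul_add, smul_comm]
    · simp only [b_add_left, b_add_right, b_smul_left, b_smul_right, hxx, hxy, hyx]
      rcases hyy with h | h <;> rw [h]
      · simp
      · norm_cast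
        simp

section Diagonal

variable {u p q : C3} {d e f : ℂ}

theorem diagonalizable_of_isFrame (h : IsFrame u p q) (hu : M.mulVec u = d • u)
    (hp : M.mulVec p = e • p) (hq : M.mulVec q = f • q) : Diagonalizable3 M := by
  refine ⟨![u, p, q], ![d, e, f], h.linearIndependent, h.span_range, fun i => ?_⟩
  fin_cases i <;> assumption

theorem spec3_of_isFrame (hM : Mᵀ = M) (h : IsFrame u p q) (hu : M.mulVec u = d • u)
    (hp : M.mulVec p = e • p) (hq : M.mulVec q = f • q) : spec3 M = {d, e, f} := by
  ext k
  simp only [spec3, Set.mem_ofPred_eq, Set.mem_insert_iff, Set.mem_singleton_iff]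
  constructor
  · rintro ⟨z, hz0, hz⟩
    by_contra! hk
    refine hz0 (h.eq_zero ?_ ?_ ?_)
    · exact (mul_eq_zero.mp (eigenvalue_sub_mul_b hM hz hu)).resolve_left (sub_ne_zero.mpr hk.1)
    · exact (mul_eq_zero.mp (eigenvalue_sub_mul_b hM hz hp)).resolve_left (sub_ne_zero.mpr hk.2.1)
    · exact (mul_eq_zero.mp (eigenvalue_sub_mul_b hM hz hq)).resolve_left (sub_ne_zero.mpr hk.2.2)
  · rintro (rfl | rfl | rfl)
    · exact ⟨u, ne_zero_of_b_ne_zero (w := u) (by simp [h.uu]), hu⟩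
    · exact ⟨p, ne_zero_of_b_ne_zero (w := p) (by simp [h.pp]), hp⟩
    · exact ⟨q, ne_zero_of_b_ne_zero (w := q) (by simp [h.qq]), hq⟩

theorem span_eq_of_simple (hM : Mᵀ = M) (h : IsFrame u p q)
    (hp : M.mulVec p = e • p) (hq : M.mulVec q = f • q) (hde : d ≠ e) (hdf : d ≠ f) {z : C3}
    (hz0 : z ≠ 0) (hz : M.mulVec z = d • z) : Submodule.span ℂ {z} = Submodule.span ℂ {u} := by
  have h1 := (mul_eq_zero.mp (eigenvalue_sub_mul_b hM hz hp)).resolve_left (sub_ne_zero.mpr hde)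
  have h2 := (mul_eq_zero.mp (eigenvalue_sub_mul_b hM hz hq)).resolve_left (sub_ne_zero.mpr hdf)
  have h3 := h.expand z
  rw [h1, h2, zero_smul, zero_smul, add_zero, add_zero] at h3
  rw [h3] at hz0 ⊢
  exact span_smul_eq hz0

theorem eigLines_of_isFrame (hM : Mᵀ = M) (h : IsFrame u p q) (hu : M.mulVec u = d • u)
    (hp : M.mulVec p = e • p) (hq : M.mulVec q = f • q) (hde : d ≠ e) (hdf : d ≠ f)
    (hef : e ≠ f) :
    eigLines M = {Submodule.span ℂ {u}, Submodule.span ℂ {p}, Submodule.span ℂ {q}} := by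
  ext l
  simp only [Set.mem_insert_iff, Set.mem_singleton_iff]
  constructor
  · rintro ⟨z, hz0, ⟨k, hz⟩, -, rfl⟩
    have hk : k ∈ spec3 M := ⟨z, hz0, hz⟩
    rw [spec3_of_isFrame hM h hu hp hq] at hk
    rcases hk with rfl | rfl | rfl
    · exact Or.inl (span_eq_of_simple hM h hp hq hde hdf hz0 hz)
    · exact Or.inr (Or.inl (span_eq_of_simple hM h.rotate hq hu hef hde.symm hz0 hz))
    · exact Or.inr (Or.inr (span_eq_of_simple hM h.rotate.rotate hu hp hdf.symm hef.symm hz0 hz))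
  · rintro (rfl | rfl | rfl)
    · exact span_mem_eigLines hu (by simp [h.uu])
    · exact span_mem_eigLines hp (by simp [h.pp])
    · exact span_mem_eigLines hq (by simp [h.qq])

end Diagonal

/-- The five Petrov types of a nonzero matrix, each with its invariants. -/
inductive Classified (M : Matrix (Fin 3) (Fin 3) ℂ) : Prop
  | typeI (finite : (eigLines M).Finite) (lines : (eigLines M).ncard = 3)
      (spec : (spec3 M).ncard = 3) (rank : Module.finrank ℂ (eigSpan M) = 3)
  | typeD (infinite : (eigLines M).Infinite) (diag : Diagonalizable3 M)
      (spec : (spec3 M).ncard = 2) (rank : Module.finrank ℂ (eigSpan M) = 3)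
  | typeN (infinite : (eigLines M).Infinite)
      (spec : (spec3 M).ncard = 1) (rank : Module.finrank ℂ (eigSpan M) = 2)
  | typeII (finite : (eigLines M).Finite) (lines : (eigLines M).ncard = 1)
      (spec : (spec3 M).ncard = 2) (rank : Module.finrank ℂ (eigSpan M) = 2)
  | typeIII (finite : (eigLines M).Finite) (lines : (eigLines M).ncard = 0)
      (spec : (spec3 M).ncard = 1) (rank : Module.finrank ℂ (eigSpan M) = 1)

section Diagonal

variable {u p q : C3} {d e f : ℂ}

theorem classified_of_double (hM : Mᵀ = M) (h : IsFrame u p q) (hu : M.mulVec u = d • u)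
    (hp : M.mulVec p = e • p) (hq : M.mulVec q = e • q) (hde : d ≠ e) : Classified M := by
  have hd := diagonalizable_of_isFrame h hu hp hq
  refine .typeD (eigLines_infinite hp hq h.pp h.pq ?_ (Or.inr h.qq)) hd ?_
    (finrank_eigSpan_of_diagonalizable hd)
  · exact ne_zero_of_b_ne_zero (w := q) (by simp [h.qq])
  · rw [spec3_of_isFrame hM h hu hp hq, Set.pair_eq_singleton, Set.ncard_pair hde]

theorem classified_of_diagonal (hM : Mᵀ = M) (hne : M ≠ 0) (htr : M.trace = 0)
    (h : IsFrame u p q) (hu : M.mulVec u = d • u)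
    (hp : M.mulVec p = e • p) (hq : M.mulVec q = f • q) : Classified M := by
  have ht := h.trace_eq M
  rw [htr, hu, hp, hq] at ht
  simp only [b_smul_left, h.uu, h.pp, h.qq, mul_one] at ht
  by_cases hde : d = e
  · subst hde
    by_cases hdf : d = f
    · subst hdf
      have hd0 : d = 0 := by linear_combination -ht / 3
      subst hd0
      refine absurd ?_ hne
      refine Matrix.ext_of_mulVec_single fun i => ?_
      rw [h.expand (Pi.single i 1)]
      simp only [mulVec_add, mulVec_smul, hu, hp, hq, zero_smul, smul_zero, add_zero, zero_mulVec]
    · exact classified_of_double hM h.rotate.rotate hq hu hp (Ne.symm hdf)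
  by_cases hdf : d = f
  · subst hdf
    exact classified_of_double hM h.rotate hp hq hu (Ne.symm hde)
  by_cases hef : e = f
  · subst hef
    exact classified_of_double hM h hu hp hq hde
  have hl := eigLines_of_isFrame hM h hu hp hq hde hdf hef
  refine .typeI (by rw [hl]; simp) ?_ ?_
    (finrank_eigSpan_of_diagonalizable (diagonalizable_of_isFrame h hu hp hq))
  · exact Set.ncard_eq_three.mpr ⟨_, _, _, span_singleton_ne (by simp [h.pp]) h.up,
      span_singleton_ne (by simp [h.qq]) h.uq, span_singleton_ne (by simp [h.qq]) h.pq, hl⟩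
  · exact Set.ncard_eq_three.mpr ⟨_, _, _, hde, hdf, hef, spec3_of_isFrame hM h hu hp hq⟩

/-- Two orthogonal non-isotropic eigenvectors extend to an orthonormal eigenbasis. -/
theorem classified_of_orthogonal_pair (hM : Mᵀ = M) (hne : M ≠ 0) (htr : M.trace = 0)
    (hu : M.mulVec u = d • u) (uu : b u u = 1) (hp : M.mulVec p = e • p) (hpp : b p p ≠ 0)
    (hup : b u p = 0) : Classified M := by
  obtain ⟨c, hc⟩ := exists_smul_b_eq_one hpp
  have h := isFrame_crossProduct uu hc (by simp [hup])
  refine classified_of_diagonal hM hne htr h hu (e := e) (by rw [mulVec_smul, hp, smul_comm])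
    (f := b (M.mulVec (crossProduct u (c • p))) (crossProduct u (c • p)))
    ((h.expand _).trans ?_)
  rw [b_mulVec hM, b_mulVec hM _ (c • p), hu, mulVec_smul, hp, b_smul_right, b_comm, h.uq,
    smul_comm c e p, b_smul_right, b_comm _ (c • p), h.pq]
  simp only [mul_zero, zero_smul, zero_add]

end Diagonal

/-- The case of a non-isotropic eigenvector `u` whose orthogonal complement contains a single,
isotropic, eigenvector line. -/
theorem classified_of_degenerate {u n : C3} {d : ℂ} (hu : M.mulVec u = d • u)
    (uu : b u u = 1) (hn : M.mulVec n = (-d / 2) • n) (hn0 : n ≠ 0) (hun : b u n = 0)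
    (hnn : b n n = 0)
    (hz : ∀ (z : C3) (k : ℂ), M.mulVec z = k • z →
      (k - d) * b z u = 0 ∧ ∃ y : ℂ, z = b z u • u + y • n ∧ (k = -d / 2 ∨ y = 0)) :
    Classified M := by
  have hu0 : u ≠ 0 := ne_zero_of_b_ne_zero (w := u) (by simp [uu])
  have hspec : spec3 M = {d, -d / 2} := by
    ext k
    constructor
    · rintro ⟨z, hz0, h⟩
      obtain ⟨h1, y, h2, h3⟩ := hz z k h
      by_contra hk
      simp only [Set.mem_insert_iff, Set.mem_singleton_iff, not_or] at hk
      rw [(mul_eq_zero.mp h1).resolve_left (sub_ne_zero.mpr hk.1), h3.resolve_left hk.2] at h2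
      exact hz0 (by simpa using h2)
    · rintro (rfl | rfl)
      · exact ⟨u, hu0, hu⟩
      · exact ⟨n, hn0, hn⟩
  have hspan : eigSpan M = Submodule.span ℂ (Set.range ![u, n]) := by
    apply le_antisymm
    · refine Submodule.span_le.mpr ?_
      rintro z ⟨-, k, h⟩
      obtain ⟨-, y, h2, -⟩ := hz z k h
      rw [h2]
      exact add_mem (Submodule.smul_mem _ _ (Submodule.subset_span ⟨0, rfl⟩))
        (Submodule.smul_mem _ _ (Submodule.subset_span ⟨1, rfl⟩))
    · refine Submodule.span_mono ?_
      rintro _ ⟨i, rfl⟩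
      fin_cases i
      · exact ⟨hu0, d, hu⟩
      · exact ⟨hn0, _, hn⟩
  have hind : LinearIndependent ℂ ![u, n] := by
    rw [LinearIndependent.pair_iff]
    intro s t hst
    have hs : s = 0 := by
      simpa [uu, b_comm n u, hun] using congrArg (b · u) hst
    subst hs
    exact ⟨rfl, by simpa [hn0] using hst⟩
  have hrank : Module.finrank ℂ (eigSpan M) = 2 := by
    rw [hspan, finrank_span_eq_card hind]
    simp
  by_cases hd : d = 0
  · subst hd
    refine .typeN (eigLines_infinite hu (by simpa using hn) uu hun hn0 (Or.inl hnn)) ?_ hrank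
    rw [hspec]
    simp
  · have hd2 : d ≠ -d / 2 := by
      intro h
      exact hd (by linear_combination 2 / 3 * h)
    have hlines : eigLines M = {Submodule.span ℂ {u}} := by
      ext l
      constructor
      · rintro ⟨z, hz0, ⟨k, h⟩, hb, rfl⟩
        obtain ⟨h1, y, h2, h3⟩ := hz z k h
        rcases h3 with rfl | rfl
        · have hx := (mul_eq_zero.mp h1).resolve_left (sub_ne_zero.mpr hd2.symm)
          rw [hx] at h2
          rw [h2] at hb
          simp [hnn] at hb
        · rw [zero_smul, add_zero] at h2
          rw [h2] at hz0 ⊢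
          exact span_smul_eq hz0
      · rintro rfl
        exact span_mem_eigLines hu (by simp [uu])
    refine .typeII (by rw [hlines]; simp) (by rw [hlines]; simp) ?_ hrank
    rw [hspec, Set.ncard_pair hd2]

theorem classified_of_nonisotropic (hM : Mᵀ = M) (hne : M ≠ 0) (htr : M.trace = 0) {u : C3}
    {d : ℂ} (hu : M.mulVec u = d • u) (uu : b u u = 1) : Classified M := by
  obtain ⟨p, q, h⟩ := exists_isFrame uu
  have hpu : b (M.mulVec p) u = 0 := by
    rw [b_mulVec hM, hu, b_smul_right, b_comm, h.up, mul_zero]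
  have hqu : b (M.mulVec q) u = 0 := by
    rw [b_mulVec hM, hu, b_smul_right, b_comm, h.uq, mul_zero]
  have ht := h.trace_eq M
  have hp := h.expand (M.mulVec p)
  have hq := h.expand (M.mulVec q)
  rw [hu, b_smul_left, uu, htr] at ht
  rw [hpu, zero_smul, zero_add] at hp
  rw [hqu, zero_smul, zero_add, b_mulVec hM q p, b_comm q] at hq
  set α := b (M.mulVec p) p
  set β := b (M.mulVec p) q
  set γ := b (M.mulVec q) q
  have hqp := (b_comm q p).trans h.pq
  by_cases hβ : β = 0
  · rw [hβ, zero_smul, add_zero] at hp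
    exact classified_of_orthogonal_pair hM hne htr hu uu hp (by simp [h.pp]) h.up
  obtain ⟨r, hr⟩ := IsAlgClosed.exists_pow_nat_eq ((α - γ) ^ 2 + 4 * β ^ 2) (n := 2) (by norm_num)
  set ε := (γ - α + r) / (2 * β) with hε
  have hεβ : 2 * β * ε = γ - α + r := by
    rw [hε]
    field_simp
  have hn : M.mulVec (p + ε • q) = ((α + γ + r) / 2) • (p + ε • q) := by
    have h1 : α + ε * β = (α + γ + r) / 2 := by linear_combination hεβ / 2
    have h2 : β + ε * γ = (α + γ + r) / 2 * ε := by
      apply mul_left_cancel₀ hβ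
      linear_combination (γ - α - r) / 4 * hεβ - hr / 4
    rw [mulVec_add, mulVec_smul, hp, hq, smul_add _ p, smul_smul _ ε, ← h2, ← h1]
    module
  have hun : b u (p + ε • q) = 0 := by simp [h.up, h.uq]
  have hnn : b (p + ε • q) (p + ε • q) = 1 + ε ^ 2 := by
    simp [h.pp, h.qq, h.pq, hqp]
    ring
  by_cases hiso : 1 + ε ^ 2 = 0
  swap
  · exact classified_of_orthogonal_pair hM hne htr hu uu hn (hnn ▸ hiso) hun
  have hr0 : r = 0 := by
    have h1 : r * (γ - α + r) = 0 := by
      linear_combination 2 * β ^ 2 * hiso - (2 * β * ε + γ - α + r) / 2 * hεβ + hr / 2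
    rcases mul_eq_zero.mp h1 with h1 | h1
    · exact h1
    · rw [h1] at hεβ
      have : ε = 0 := by simpa [hβ] using hεβ
      rw [this] at hiso
      norm_num at hiso
  have hk : (α + γ + r) / 2 = -d / 2 := by
    rw [hr0]
    linear_combination -ht / 2
  rw [hk] at hn
  refine classified_of_degenerate hu uu hn ?_ hun (hnn.trans hiso) fun z k hz => ?_
  · exact ne_zero_of_b_ne_zero (w := p) (by simp [h.pp, hqp])
  refine ⟨eigenvalue_sub_mul_b hM hz hu, b z p, ?_⟩
  have e1 := b_mulVec hM z p
  have e2 := b_mulVec hM z q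
  rw [hz, hp] at e1
  rw [hz, hq] at e2
  simp only [b_smul_left, b_smul_right, b_add_right] at e1 e2
  have hsq : ∀ y : ℂ, ((k - α) * (k - γ) - β ^ 2) * y = 0 → k = -d / 2 ∨ y = 0 := by
    intro y hy
    have : (k - -d / 2) ^ 2 * y = 0 := by
      rw [hr0] at hr
      have ht' : d = -α - γ := by linear_combination -ht
      rw [ht']
      linear_combination hy - y / 4 * hr
    rcases mul_eq_zero.mp this with h1 | h1
    · exact Or.inl (sub_eq_zero.mp (pow_eq_zero_iff two_ne_zero |>.mp h1))
    · exact Or.inr h1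
  have hy := hsq (b z p) (by linear_combination (k - γ) * e1 + β * e2)
  have hw := hsq (b z q) (by linear_combination (k - α) * e2 + β * e1)
  refine ⟨?_, hy⟩
  have hqz : b z q = ε * b z p := by
    by_cases hkd : k = -d / 2
    · apply mul_left_cancel₀ hβ
      rw [hkd, ← hk] at e1
      linear_combination -e1 - b z p / 2 * hεβ
    · rw [hy.resolve_left hkd, hw.resolve_left hkd, mul_zero]
  conv_lhs => rw [h.expand z, hqz]
  module

theorem classified_of_isotropic (hM : Mᵀ = M)
    (hiso : ∀ (z : C3) (k : ℂ), M.mulVec z = k • z → b z z = 0) : Classified M := by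
  obtain ⟨k, hk⟩ := Module.End.exists_eigenvalue (Matrix.toLin' M)
  obtain ⟨z, hz⟩ := hk.exists_hasEigenvector
  have hz0 := hz.2
  have hzk : M.mulVec z = k • z := by simpa using hz.apply_eq_smul
  have hpar : ∀ (w : C3) (l : ℂ), M.mulVec w = l • w → ∃ c : ℂ, w = c • z := by
    intro w l hw
    refine exists_eq_smul_of_isotropic hz0 (hiso z k hzk) (hiso w l hw) ?_
    by_cases hkl : k = l
    · subst hkl
      have h1 := hiso (z + w) k (by rw [mulVec_add, hzk, hw, smul_add])
      simp only [b_add_left, b_add_right, hiso z k hzk, hiso w k hw, b_comm w z] at h1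
      linear_combination h1 / 2
    · exact (mul_eq_zero.mp (eigenvalue_sub_mul_b hM hzk hw)).resolve_left (sub_ne_zero.mpr hkl)
  have hlines : eigLines M = ∅ := by
    rw [Set.eq_empty_iff_forall_notMem]
    rintro l ⟨w, -, ⟨j, hw⟩, hb, -⟩
    exact hb (hiso w j hw)
  have hspec : spec3 M = {k} := by
    ext l
    constructor
    · rintro ⟨w, hw0, hw⟩
      obtain ⟨c, rfl⟩ := hpar w l hw
      rw [mulVec_smul, hzk, smul_comm] at hw
      exact (smul_left_injective ℂ hw0 hw).symm
    · rintro rfl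
      exact ⟨z, hz0, hzk⟩
  have hspan : eigSpan M = Submodule.span ℂ {z} := by
    apply le_antisymm
    · refine Submodule.span_le.mpr ?_
      rintro w ⟨-, l, hw⟩
      obtain ⟨c, rfl⟩ := hpar w l hw
      exact Submodule.smul_mem _ _ (Submodule.mem_span_singleton_self z)
    · refine Submodule.span_mono ?_
      rintro _ rfl
      exact ⟨hz0, k, hzk⟩
  exact .typeIII (by rw [hlines]; simp) (by rw [hlines]; simp) (by rw [hspec]; simp)
    (by rw [hspan, finrank_span_singleton hz0])

theorem classified (hM : Mᵀ = M) (hne : M ≠ 0) (htr : M.trace = 0) : Classified M := by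
  by_cases hiso : ∀ (z : C3) (k : ℂ), M.mulVec z = k • z → b z z = 0
  · exact classified_of_isotropic hM hiso
  · push Not at hiso
    obtain ⟨z, k, hz, hb⟩ := hiso
    obtain ⟨c, hc⟩ := exists_smul_b_eq_one hb
    exact classified_of_nonisotropic hM hne htr (d := k)
      (by rw [mulVec_smul, hz, smul_comm]) hc

end Petrov

/-- the Petrov-type classification by critical-point count,
Theorem `thm:n2`: for a nonzero trace-free complex symmetric 3×3 matrix `M`,
the number `N(M)` of eigenvector lines `ℓ` with `b(z,z) ≠ 0` determines the
Petrov type: `N(M) = 3` ⟺ Type I, `N(M) = ∞` ⟺ Type D or N, `N(M) = 1` ⟺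
Type II, `N(M) = 0` ⟺ Type III. -/
theorem stmt17 (M : Matrix (Fin 3) (Fin 3) ℂ) (hM : Mᵀ = M)
    (hne : M ≠ 0) (htr : M.trace = 0) :
    (((eigLines M).Finite ∧ (eigLines M).ncard = 3) ↔ (spec3 M).ncard = 3) ∧
    ((eigLines M).Infinite ↔
      ((Diagonalizable3 M ∧ (spec3 M).ncard = 2) ∨
        ((spec3 M).ncard = 1 ∧ Module.finrank ℂ (eigSpan M) = 2))) ∧
    (((eigLines M).Finite ∧ (eigLines M).ncard = 1) ↔
      (¬ Diagonalizable3 M ∧ (spec3 M).ncard = 2)) ∧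
    (((eigLines M).Finite ∧ (eigLines M).ncard = 0) ↔
      Module.finrank ℂ (eigSpan M) = 1) := by
  have hdiag := Petrov.finrank_eigSpan_of_diagonalizable (M := M)
  rcases Petrov.classified hM hne htr with
    ⟨hf, hl, hs, hr⟩ | ⟨hi, hd, hs, hr⟩ | ⟨hi, hs, hr⟩ | ⟨hf, hl, hs, hr⟩ | ⟨hf, hl, hs, hr⟩
  · simp [hf, hl, hs, hr, Set.Infinite]
  · simp [hi, hd, hs, hr]
  · simp [hi, hs, hr]
  · have hnd : ¬ Diagonalizable3 M := fun h => by simp [hdiag h] at hr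
    simp [hf, hl, hs, hr, hnd, Set.Infinite]
  · simp [hf, hl, hs, hr, Set.Infinite]
end

section
/- Equip ℝ⁴ = ℝ²×ℝ² with the symmetric bilinear forms g₁(x,y) := x₁y₁ + x₂y₂ and g₂(x,y) := x₃y₃ + x₄y₄, and for c₁, c₂ ∈ ℝ let W := ((c₁+c₂)/6)·(g₁⊙g₁ − g₁⊙g₂ + g₂⊙g₂), the Weyl tensor of a Riemannian product of two surfaces of constant curvatures c₁ and c₂. If c₁ + c₂ ≠ 0 and T ∈ ℝ⁴ satisfies W(T,x,y,T) = 0 for all x,y ∈ ℝ⁴, then T = 0. -/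
/-- Vectors in ℝ⁴ = ℝ² × ℝ². -/
abbrev V4 : Type := Fin 4 → ℝ

/-- The bilinear form `g₁(x,y) = x₁y₁ + x₂y₂` (the first-factor metric). -/
def g1 (x y : V4) : ℝ := x 0 * y 0 + x 1 * y 1

/-- The bilinear form `g₂(x,y) = x₃y₃ + x₄y₄` (the second-factor metric). -/
def g2 (x y : V4) : ℝ := x 2 * y 2 + x 3 * y 3

/-- The Kulkarni–Nomizu product of two symmetric bilinear forms. -/
def KN (h k : V4 → V4 → ℝ) (x y z w : V4) : ℝ :=
  h x z * k y w + h y w * k x z - h x w * k y z - h y z * k x w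

/-- The Weyl tensor of a Riemannian product of two surfaces of constant
curvatures `c₁` and `c₂`:
`W = ((c₁+c₂)/6)(g₁⊙g₁ − g₁⊙g₂ + g₂⊙g₂)`. -/
noncomputable def Wprod (c1 c2 : ℝ) (x y z w : V4) : ℝ :=
  ((c1 + c2) / 6) * (KN g1 g1 x y z w - KN g1 g2 x y z w + KN g2 g2 x y z w)

/-- example (i) in Section 3: if `c₁ + c₂ ≠ 0`, then the only
vector `T` with `W(T,·,·,T) = 0` for the product Weyl tensor is `T = 0`. -/
theorem stmt18 (c1 c2 : ℝ) (hc : c1 + c2 ≠ 0) (T : V4)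
    (hT : ∀ x y : V4, Wprod c1 c2 T x y T = 0) :
    T = 0 := by
  have hK : ∀ x y : V4,
      KN g1 g1 T x y T - KN g1 g2 T x y T + KN g2 g2 T x y T = 0 := fun x y =>
    (mul_eq_zero.mp (hT x y)).resolve_left (div_ne_zero hc (by norm_num))
  have h01 := hK ![1, 0, 0, 0] ![0, 1, 0, 0]
  have h00 := hK ![1, 0, 0, 0] ![1, 0, 0, 0]
  have h11 := hK ![0, 1, 0, 0] ![0, 1, 0, 0]
  have h22 := hK ![0, 0, 1, 0] ![0, 0, 1, 0]
  have h33 := hK ![0, 0, 0, 1] ![0, 0, 0, 1]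
  simp [KN, g1, g2] at h01 h00 h11 h22 h33
  have hprod : T 0 * T 1 = 0 := by linarith
  have hsq : T 0 ^ 2 = T 1 ^ 2 := by linarith
  have h0 : T 0 = 0 := by
    rcases mul_eq_zero.mp hprod with h | h
    · exact h
    · simpa [h] using hsq
  have h1 : T 1 = 0 := by simpa [h0] using hsq.symm
  have h2 : T 2 = 0 := by
    rw [h0, h1] at h33
    exact pow_eq_zero_iff two_ne_zero |>.mp (by linarith)
  have h3 : T 3 = 0 := by
    rw [h0, h1] at h22
    exact pow_eq_zero_iff two_ne_zero |>.mp (by linarith)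
  ext i
  fin_cases i <;> assumption
end

section
/- Let W be an algebraic Weyl tensor on Euclidean ℝ⁴ that is self-dual or anti-self-dual, i.e., either Ŵ_g ξ = 0 for every ξ ∈ ℝ⁶ with Sξ = −ξ, or Ŵ_g ξ = 0 for every ξ ∈ ℝ⁶ with Sξ = ξ. If there exists a nonzero T ∈ ℝ⁴ with W(T,x,y,T) = 0 for all x,y ∈ ℝ⁴, then W = 0. -/
open scoped BigOperators

/-- ℝ⁶, identified with Λ²ℝ⁴ via the ordered basis
`e₁∧e₂, e₁∧e₃, e₁∧e₄, e₃∧e₄, e₄∧e₂, e₂∧e₃`. -/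
abbrev V6 : Type := Fin 6 → ℝ

/-- Covariant 4-tensors (multilinear maps ℝ⁴×ℝ⁴×ℝ⁴×ℝ⁴ → ℝ). -/
abbrev Tensor4 : Type := MultilinearMap ℝ (fun _ : Fin 4 => V4) ℝ

/-- Evaluation of a 4-tensor on four vectors. -/
def tapp (W : Tensor4) (x y z w : V4) : ℝ := W ![x, y, z, w]

/-- Standard basis of ℝ⁴ (0-indexed: `e 0 = e₁`, …, `e 3 = e₄`). -/
def e (i : Fin 4) : V4 := Pi.single i 1

/-- Standard basis of ℝ⁶ (0-indexed: `u 0 = u₁`, …, `u 5 = u₆`). -/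
def u (c : Fin 6) : V6 := Pi.single c 1

/-- The index pairs of the six coordinate 2-planes
`e₁∧e₂, e₁∧e₃, e₁∧e₄, e₃∧e₄, e₄∧e₂, e₂∧e₃` (0-indexed). -/
def pairs : Fin 6 → Fin 4 × Fin 4 := ![(0,1), (0,2), (0,3), (2,3), (3,1), (1,2)]

/-- The Minkowski inner product `η` on ℝ⁴ (timelike direction `e₁`). -/
def etaR4 (x y : V4) : ℝ := -(x 0 * y 0) + x 1 * y 1 + x 2 * y 2 + x 3 * y 3

/-- The Lorentzian inner product `⟨·,·⟩_L` on ℝ⁶, of signature (−−−+++). -/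
def ipL (ξ η : V6) : ℝ :=
  -(ξ 0 * η 0) - ξ 1 * η 1 - ξ 2 * η 2 + ξ 3 * η 3 + ξ 4 * η 4 + ξ 5 * η 5

/-- The matrix of the Lorentzian Hodge star `J = [[0, I₃],[−I₃, 0]]`. -/
def Jmat : Matrix (Fin 6) (Fin 6) ℝ :=
  !![0,0,0,1,0,0;
     0,0,0,0,1,0;
     0,0,0,0,0,1;
     -1,0,0,0,0,0;
     0,-1,0,0,0,0;
     0,0,-1,0,0,0]

/-- The Lorentzian Hodge star `J` as a linear map on ℝ⁶. -/
def J : V6 →ₗ[ℝ] V6 := Matrix.toLin' Jmat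

/-- The matrix of the Riemannian Hodge star `S = [[0, I₃],[I₃, 0]]`. -/
def Smat : Matrix (Fin 6) (Fin 6) ℝ :=
  !![0,0,0,1,0,0;
     0,0,0,0,1,0;
     0,0,0,0,0,1;
     1,0,0,0,0,0;
     0,1,0,0,0,0;
     0,0,1,0,0,0]

/-- The Riemannian Hodge star `S` as a linear map on ℝ⁶. -/
def S : V6 →ₗ[ℝ] V6 := Matrix.toLin' Smat

/-- `W` is an algebraic Weyl tensor on Euclidean ℝ⁴. -/
def IsWeylE (W : Tensor4) : Prop :=
  (∀ x y z w, tapp W x y z w = - tapp W y x z w) ∧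
  (∀ x y z w, tapp W x y z w = - tapp W x y w z) ∧
  (∀ x y z w, tapp W x y z w = tapp W z w x y) ∧
  (∀ x y z w, tapp W x y z w + tapp W y z x w + tapp W z x y w = 0) ∧
  (∀ x y, ∑ i : Fin 4, tapp W (e i) x y (e i) = 0)

/-- `W` is an algebraic Weyl tensor on Minkowski ℝ⁴ (η-trace-free). -/
def IsWeylM (W : Tensor4) : Prop :=
  (∀ x y z w, tapp W x y z w = - tapp W y x z w) ∧
  (∀ x y z w, tapp W x y z w = - tapp W x y w z) ∧
  (∀ x y z w, tapp W x y z w = tapp W z w x y) ∧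
  (∀ x y z w, tapp W x y z w + tapp W y z x w + tapp W z x y w = 0) ∧
  (∀ x y, -(tapp W (e 0) x y (e 0)) + tapp W (e 1) x y (e 1)
      + tapp W (e 2) x y (e 2) + tapp W (e 3) x y (e 3) = 0)

/-- `WL` is the Lorentzian Weyl operator of `W`:
`⟨WL u_c, u_r⟩_L = W(e_{i(c)}, e_{j(c)}, e_{i(r)}, e_{j(r)})`. -/
def IsLorentzWeylOp (W : Tensor4) (WL : V6 →ₗ[ℝ] V6) : Prop :=
  ∀ c r : Fin 6,
    ipL (WL (u c)) (u r) =
      tapp W (e (pairs c).1) (e (pairs c).2) (e (pairs r).1) (e (pairs r).2)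

/-- `Wg` is the Riemannian Weyl operator of `W`:
`⟨Wg u_c, u_r⟩ = W(e_{i(c)}, e_{j(c)}, e_{i(r)}, e_{j(r)})` w.r.t. the dot product. -/
def IsRiemWeylOp (W : Tensor4) (Wg : V6 →ₗ[ℝ] V6) : Prop :=
  ∀ c r : Fin 6,
    (∑ i : Fin 6, Wg (u c) i * u r i) =
      tapp W (e (pairs c).1) (e (pairs c).2) (e (pairs r).1) (e (pairs r).2)

/-- The coordinates of the bivector `x ∧ y` in the basis of `Λ²ℝ⁴` indexed by `pairs`. -/
def wedge (x y : V4) (c : Fin 6) : ℝ :=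
  x (pairs c).1 * y (pairs c).2 - x (pairs c).2 * y (pairs c).1

/-- The entry of the curvature matrix of `W` at the coordinate planes `c` and `d`. -/
def planeEntry (W : Tensor4) (c d : Fin 6) : ℝ :=
  tapp W (e (pairs c).1) (e (pairs c).2) (e (pairs d).1) (e (pairs d).2)

theorem IsLinearMap.eq_sum_e {f : V4 → ℝ} (hf : IsLinearMap ℝ f) (x : V4) :
    f x = ∑ i, x i * f (e i) := by
  have h := (hf.mk' f).pi_apply_eq_sum_univ x
  simp only [IsLinearMap.mk'_apply, smul_eq_mul] at h
  rw [h]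
  refine Finset.sum_congr rfl fun i _ => ?_
  congr 2
  ext j
  simp [e, Pi.single_apply, eq_comm]

theorem eq_sum_wedge {f : V4 → V4 → ℝ} (hf : ∀ y, IsLinearMap ℝ fun x => f x y)
    (hanti : ∀ x y, f x y = -f y x) (x y : V4) :
    f x y = ∑ c, wedge x y c * f (e (pairs c).1) (e (pairs c).2) := by
  have hright (i : Fin 4) : f (e i) y = ∑ j, y j * f (e i) (e j) := by
    rw [hanti, (hf (e i)).eq_sum_e y, ← Finset.sum_neg_distrib]
    exact Finset.sum_congr rfl fun j _ => by rw [hanti (e i)]; ring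
  have hself (i : Fin 4) : f (e i) (e i) = 0 := by linarith [hanti (e i) (e i)]
  rw [(hf y).eq_sum_e x]
  simp only [hright, Fin.sum_univ_four, Fin.sum_univ_six, wedge, pairs, hself]
  simp only [Matrix.cons_val]
  rw [hanti (e 1) (e 0), hanti (e 2) (e 0), hanti (e 3) (e 0), hanti (e 3) (e 2),
    hanti (e 3) (e 1), hanti (e 2) (e 1)]
  ring

theorem isLinearMap_tapp (W : Tensor4) (y z w : V4) :
    IsLinearMap ℝ fun x => tapp W x y z w :=
  ⟨fun a b => W.cons_add ![y, z, w] a b, fun r a => W.cons_smul ![y, z, w] r a⟩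

namespace IsWeylE

variable {W : Tensor4}

theorem planeEntry_comm (hW : IsWeylE W) (c d : Fin 6) : planeEntry W c d = planeEntry W d c :=
  hW.2.2.1 _ _ _ _

theorem tapp_eq_sum (hW : IsWeylE W) (x y z w : V4) :
    tapp W x y z w = ∑ c, ∑ d, wedge x y c * wedge z w d * planeEntry W c d := by
  obtain ⟨hleft, hright, hpair, -, -⟩ := hW
  rw [eq_sum_wedge (f := fun x y => tapp W x y z w) (fun y => isLinearMap_tapp W y z w)
    (fun x y => hleft x y z w) x y]
  refine Finset.sum_congr rfl fun c _ => ?_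
  rw [eq_sum_wedge (f := fun z w => tapp W (e (pairs c).1) (e (pairs c).2) z w)
    (fun w => by simpa only [hpair _ _ _ w] using isLinearMap_tapp W w _ _)
    (fun z w => hright _ _ z w) z w, Finset.mul_sum]
  exact Finset.sum_congr rfl fun d _ => (mul_assoc _ _ _).symm

end IsWeylE

theorem IsRiemWeylOp.apply_u {W : Tensor4} {Wg : V6 →ₗ[ℝ] V6} (hWg : IsRiemWeylOp W Wg)
    (c r : Fin 6) : Wg (u c) r = planeEntry W c r := by
  simpa [u, Pi.single_apply, planeEntry] using hWg c r

/-- The coordinates of the projection of `x ∧ y` to the `ε`-eigenspace of the Hodge star,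
for `ε = 1` or `ε = -1`. -/
def dualPart (ε : ℝ) (x y : V4) (a : Fin 3) : ℝ :=
  wedge x y (Fin.castAdd 3 a) + ε * wedge x y (Fin.natAdd 3 a)

theorem tapp_eq_sum_dualPart {W : Tensor4} {ε : ℝ} (hW : IsWeylE W)
    (hstar : ∀ (a : Fin 3) (d : Fin 6),
      planeEntry W (Fin.natAdd 3 a) d = ε * planeEntry W (Fin.castAdd 3 a) d)
    (x y z w : V4) :
    tapp W x y z w = ∑ a, ∑ b, dualPart ε x y a * dualPart ε z w b *
      planeEntry W (Fin.castAdd 3 a) (Fin.castAdd 3 b) := by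
  have hstar' (c : Fin 6) (b : Fin 3) :
      planeEntry W c (Fin.natAdd 3 b) = ε * planeEntry W c (Fin.castAdd 3 b) := by
    rw [hW.planeEntry_comm, hstar, hW.planeEntry_comm]
  have hsplit (g : Fin 6 → ℝ) :
      ∑ c, g c = ∑ a : Fin 3, (g (Fin.castAdd 3 a) + g (Fin.natAdd 3 a)) := by
    rw [Finset.sum_add_distrib]
    exact Fin.sum_univ_add (a := 3) (b := 3) g
  rw [hW.tapp_eq_sum]
  simp only [hsplit, ← Finset.sum_add_distrib]
  refine Finset.sum_congr rfl fun a _ => Finset.sum_congr rfl fun b _ => ?_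
  simp only [hstar, hstar', dualPart]
  ring

theorem exists_dualPart_eq_single {ε : ℝ} (hε : ε ^ 2 = 1) (T : V4) (a : Fin 3) :
    ∃ x, dualPart ε T x = Pi.single a (∑ i, T i ^ 2) := by
  refine ⟨![![-T 1, T 0, -ε * T 3, ε * T 2], ![-T 2, ε * T 3, T 0, -ε * T 1],
    ![-T 3, -ε * T 2, ε * T 1, T 0]] a, funext fun b => ?_⟩
  fin_cases a <;> fin_cases b <;>
    simp [dualPart, wedge, pairs, Fin.sum_univ_four, Fin.natAdd, Fin.castAdd, Fin.castLE] <;>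
    grind

theorem eq_zero_of_star_eigen {W : Tensor4} {Wg : V6 →ₗ[ℝ] V6} {ε : ℝ} (hε : ε ^ 2 = 1)
    (hW : IsWeylE W) (hWg : IsRiemWeylOp W Wg) (hsd : ∀ ξ : V6, S ξ = -(ε • ξ) → Wg ξ = 0)
    {T : V4} (hT : T ≠ 0) (hWT : ∀ x y : V4, tapp W T x y T = 0) : W = 0 := by
  have hstar (a : Fin 3) (d : Fin 6) :
      planeEntry W (Fin.natAdd 3 a) d = ε * planeEntry W (Fin.castAdd 3 a) d := by
    have hS : S (u (Fin.natAdd 3 a) - ε • u (Fin.castAdd 3 a)) =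
        -(ε • (u (Fin.natAdd 3 a) - ε • u (Fin.castAdd 3 a))) := by
      ext r
      fin_cases a <;> fin_cases r <;>
        simp [S, Smat, u, Matrix.mulVec, dotProduct, Fin.sum_univ_six, Fin.natAdd, Fin.castAdd,
          Fin.castLE, Pi.single_apply] <;>
        grind
    have h := congrFun (hsd _ hS) d
    simp only [map_sub, map_smul, Pi.sub_apply, Pi.smul_apply, smul_eq_mul, Pi.zero_apply,
      hWg.apply_u] at h
    linarith
  have hnorm : ∑ i, T i ^ 2 ≠ 0 := fun h => hT <| funext fun i =>
    pow_eq_zero_iff two_ne_zero |>.1 <|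
      (Finset.sum_eq_zero_iff_of_nonneg fun i _ => sq_nonneg (T i)).1 h i (Finset.mem_univ i)
  have hentry (a b : Fin 3) : planeEntry W (Fin.castAdd 3 a) (Fin.castAdd 3 b) = 0 := by
    obtain ⟨x, hx⟩ := exists_dualPart_eq_single hε T a
    obtain ⟨y, hy⟩ := exists_dualPart_eq_single hε T b
    have h := hWT x y
    rw [hW.2.1, neg_eq_zero, tapp_eq_sum_dualPart hW hstar, hx, hy] at h
    simpa [Pi.single_apply, hnorm] using h
  refine MultilinearMap.ext fun m => ?_
  have hm : m = ![m 0, m 1, m 2, m 3] := by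
    ext i
    fin_cases i <;> rfl
  rw [hm]
  change tapp W _ _ _ _ = 0
  simp [tapp_eq_sum_dualPart hW hstar, hentry]

/-- example (ii) in Section 3: a self-dual or anti-self-dual
algebraic Weyl tensor on Euclidean ℝ⁴ admitting a nonzero `T` with
`W(T,·,·,T) = 0` must vanish. -/
theorem stmt19 (W : Tensor4) (Wg : V6 →ₗ[ℝ] V6)
    (hW : IsWeylE W) (hWg : IsRiemWeylOp W Wg)
    (hsd : (∀ ξ : V6, S ξ = -ξ → Wg ξ = 0) ∨ (∀ ξ : V6, S ξ = ξ → Wg ξ = 0))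
    (hT : ∃ T : V4, T ≠ 0 ∧ ∀ x y : V4, tapp W T x y T = 0) :
    W = 0 := by
  obtain ⟨T, hT, hWT⟩ := hT
  rcases hsd with hsd | hsd
  · exact eq_zero_of_star_eigen (ε := 1) (by norm_num) hW hWg (by simpa using hsd) hT hWT
  · exact eq_zero_of_star_eigen (ε := -1) (by norm_num) hW hWg (by simpa using hsd) hT hWT
end
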